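/- There exists a universal constant C > 0 such that for every nonnegative, continuously differentiable function f on ℝ² with finite mass M := ∫_{ℝ²} f dx, finite Fisher information I(f), finite ∫ f³ dx, and every A > 1, one has ∫_{{f ≥ A}} f² dx ≤ C · M^{1/2} · (H⁺(f) / log A)^{1/2} · I(f), where H⁺(f) := ∫_{ℝ²} f (log f)₊ dx. -/

import Mathlib

open MeasureTheory Real

noncomputable section

open scoped ENNReal NNReal Topology
open Filter

/-- The plane. -/
abbrev Pl := EuclideanSpace ℝ (Fin 2)

lemma sob_compact : ∃ K : ℝ≥0, ∀ u : Pl → ℝ, ContDiff ℝ 1 u → HasCompactSupport u →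
    ∫⁻ x, ‖u x‖ₑ ^ 2 ≤ K * (∫⁻ x, ‖fderiv ℝ u x‖ₑ) ^ 2 := by
  refine ⟨lintegralPowLePowLIntegralFDerivConst (volume : Measure Pl) 2, fun u hu h2 => ?_⟩
  have hp : Real.HolderConjugate (Module.finrank ℝ Pl) 2 := by
    rw [finrank_euclideanSpace_fin]; exact Real.HolderConjugate.two_two
  have := lintegral_pow_le_pow_lintegral_fderiv (volume : Measure Pl) hu h2 hp
  simpa only [ENNReal.rpow_ofNat] using this

lemma exists_cutoff : ∃ χ : Pl → ℝ, ContDiff ℝ 1 χ ∧ HasCompactSupport χ ∧ (∀ x, ‖χ x‖ ≤ 1) ∧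
    (χ 0 = 1) ∧ ∃ B : ℝ≥0, ∀ x, ‖fderiv ℝ χ x‖₊ ≤ B := by
  let b : ContDiffBump (0 : Pl) := ⟨1, 2, by norm_num, by norm_num⟩
  have hc : ContDiff ℝ 1 b := b.contDiff
  refine ⟨b, hc, b.hasCompactSupport, fun x => ?_, ?_, ?_⟩
  · rw [Real.norm_eq_abs, abs_of_nonneg b.nonneg]; exact b.le_one
  · exact b.one_of_mem_closedBall (by simp [b])
  · obtain ⟨B, hB⟩ := (b.hasCompactSupport.fderiv (𝕜 := ℝ)).exists_bound_of_continuous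
      (hc.continuous_fderiv (by norm_num))
    refine ⟨B.toNNReal, fun x => ?_⟩
    rw [← NNReal.coe_le_coe, coe_nnnorm]
    exact (hB x).trans (Real.le_coe_toNNReal B)

lemma sob_int : ∃ K : ℝ≥0, ∀ u : Pl → ℝ, ContDiff ℝ 1 u → Integrable u →
    ∫⁻ x, ‖u x‖ₑ ^ 2 ≤ K * (∫⁻ x, ‖fderiv ℝ u x‖ₑ) ^ 2 := by
  obtain ⟨K, hK⟩ := sob_compact
  obtain ⟨χ, hχ, hχc, hχ1, hχ0, B, hB⟩ := exists_cutoff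
  refine ⟨K, fun u hu hi => ?_⟩
  let c : ℕ → ℝ≥0 := fun n => 1 / ((n : ℝ≥0) + 1)
  have hc0 : ∀ n, (c n : ℝ) ≠ 0 := fun n => by simp [c]; positivity
  have hc : Tendsto c atTop (𝓝 0) := tendsto_one_div_add_atTop_nhds_zero_nat
  let w : ℕ → Pl → ℝ := fun n x => χ ((c n : ℝ) • x) * u x
  have hscale : ∀ n, ContDiff ℝ 1 (fun x : Pl => χ ((c n : ℝ) • x)) := fun n =>
    hχ.comp (contDiff_const_smul _)
  have hw : ∀ n, ContDiff ℝ 1 (w n) := fun n => (hscale n).mul hu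
  have hwc : ∀ n, HasCompactSupport (w n) := fun n =>
    (hχc.comp_smul (hc0 n)).mul_right
  have hfd : ∀ n x, ‖fderiv ℝ (w n) x‖ₑ ≤ ‖fderiv ℝ u x‖ₑ + (c n * B : ℝ≥0) * ‖u x‖ₑ := by
    intro n x
    have h1 : HasFDerivAt (fun x : Pl => χ ((c n : ℝ) • x))
        ((fderiv ℝ χ ((c n : ℝ) • x)).comp ((c n : ℝ) • ContinuousLinearMap.id ℝ Pl)) x := by
      refine HasFDerivAt.comp x (f := fun x : Pl => (c n : ℝ) • x)
        ((hχ.differentiable (by norm_num)) _).hasFDerivAt ?_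
      exact (hasFDerivAt_id x).const_smul (c n : ℝ)
    have h2 := h1.mul ((hu.differentiable (by norm_num)) x).hasFDerivAt
    have h3 : fderiv ℝ (w n) x = _ := h2.fderiv
    rw [h3]
    have h4 : ‖χ ((c n : ℝ) • x) • fderiv ℝ u x + u x • ((fderiv ℝ χ ((c n : ℝ) • x)).comp
        ((c n : ℝ) • ContinuousLinearMap.id ℝ Pl))‖ ≤ ‖fderiv ℝ u x‖ + (c n * B) * ‖u x‖ := by
      refine (norm_add_le _ _).trans (add_le_add ?_ ?_)
      · rw [norm_smul]
        exact mul_le_of_le_one_left (norm_nonneg _) (hχ1 _)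
      · rw [norm_smul, mul_comm]
        refine mul_le_mul_of_nonneg_right ?_ (norm_nonneg _)
        rw [ContinuousLinearMap.comp_smul, ContinuousLinearMap.comp_id, norm_smul]
        have : ‖fderiv ℝ χ ((c n : ℝ) • x)‖ ≤ B := hB _
        rw [Real.norm_eq_abs, abs_of_nonneg (NNReal.coe_nonneg (c n))]
        gcongr
    have h5 : ‖χ ((c n : ℝ) • x) • fderiv ℝ u x + u x • ((fderiv ℝ χ ((c n : ℝ) • x)).comp
        ((c n : ℝ) • ContinuousLinearMap.id ℝ Pl))‖₊ ≤ ‖fderiv ℝ u x‖₊ + (c n * B) * ‖u x‖₊ := h4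
    simp only [enorm_eq_nnnorm]
    exact_mod_cast h5
  have hmeas : Measurable fun x => ‖fderiv ℝ u x‖ₑ :=
    (hu.continuous_fderiv (by norm_num)).enorm.measurable
  have hbd : ∀ n, ∫⁻ x, ‖w n x‖ₑ ^ 2 ≤
      K * ((∫⁻ x, ‖fderiv ℝ u x‖ₑ) + (c n * B : ℝ≥0) * ∫⁻ x, ‖u x‖ₑ) ^ 2 := by
    intro n
    refine (hK _ (hw n) (hwc n)).trans ?_
    gcongr
    refine (lintegral_mono (hfd n)).trans ?_
    rw [lintegral_add_left hmeas, lintegral_const_mul _ hu.continuous.enorm.measurable]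
  have hlim : Tendsto (fun n => (K : ℝ≥0∞) * ((∫⁻ x, ‖fderiv ℝ u x‖ₑ) +
      (c n * B : ℝ≥0) * ∫⁻ x, ‖u x‖ₑ) ^ 2) atTop
      (𝓝 (K * (∫⁻ x, ‖fderiv ℝ u x‖ₑ) ^ 2)) := by
    have h1 : Tendsto (fun n => ((c n * B : ℝ≥0) : ℝ≥0∞)) atTop (𝓝 0) := by
      have : Tendsto (fun n => c n * B) atTop (𝓝 (0 * B)) := hc.mul_const B
      rw [zero_mul] at this
      rw [← ENNReal.coe_zero]
      exact ENNReal.tendsto_coe.2 this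
    have h2 : Tendsto (fun n => ((c n * B : ℝ≥0) : ℝ≥0∞) * ∫⁻ x, ‖u x‖ₑ) atTop (𝓝 0) := by
      have := ENNReal.Tendsto.mul_const h1 (b := ∫⁻ x, ‖u x‖ₑ) (Or.inr hi.2.ne)
      simpa using this
    have h3 := (tendsto_const_nhds (x := ∫⁻ x, ‖fderiv ℝ u x‖ₑ)).add h2
    rw [add_zero] at h3
    exact ENNReal.Tendsto.const_mul (ENNReal.Tendsto.pow h3) (Or.inr ENNReal.coe_ne_top)
  have hpt : ∀ x, Tendsto (fun n => ‖w n x‖ₑ ^ 2) atTop (𝓝 (‖u x‖ₑ ^ 2)) := by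
    intro x
    have h1 : Tendsto (fun n => (c n : ℝ) • x) atTop (𝓝 0) := by
      have : Tendsto (fun n => (c n : ℝ)) atTop (𝓝 0) := NNReal.tendsto_coe.2 hc
      simpa using this.smul_const x
    have h2 : Tendsto (fun n => w n x) atTop (𝓝 (u x)) := by
      have := ((hχ.continuous.tendsto 0).comp h1).mul_const (u x)
      simpa [hχ0] using this
    exact ENNReal.Tendsto.pow h2.enorm
  calc ∫⁻ x, ‖u x‖ₑ ^ 2 = ∫⁻ x, liminf (fun n => ‖w n x‖ₑ ^ 2) atTop := by
        congr 1; ext x; exact (hpt x).liminf_eq.symm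
    _ ≤ liminf (fun n => ∫⁻ x, ‖w n x‖ₑ ^ 2) atTop :=
        lintegral_liminf_le fun n => ((hw n).continuous.enorm.measurable.pow_const 2)
    _ ≤ liminf (fun n => (K : ℝ≥0∞) * ((∫⁻ x, ‖fderiv ℝ u x‖ₑ) +
      (c n * B : ℝ≥0) * ∫⁻ x, ‖u x‖ₑ) ^ 2) atTop := liminf_le_liminf (Eventually.of_forall hbd)
    _ = _ := hlim.liminf_eq

lemma cs_sq {μ : Measure Pl} {g h : Pl → ℝ≥0∞} (hg : AEMeasurable g μ) (hh : AEMeasurable h μ) :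
    (∫⁻ x, g x * h x ∂μ) ^ 2 ≤ (∫⁻ x, g x ^ 2 ∂μ) * ∫⁻ x, h x ^ 2 ∂μ := by
  have := ENNReal.lintegral_mul_le_Lp_mul_Lq μ Real.HolderConjugate.two_two hg hh
  simp only [ENNReal.rpow_ofNat, Pi.mul_apply] at this
  calc _ ≤ _ := pow_le_pow_left' this 2
    _ = _ := by
      rw [mul_pow, ← ENNReal.rpow_natCast, ← ENNReal.rpow_natCast, ← ENNReal.rpow_mul,
        ← ENNReal.rpow_mul]
      norm_num

lemma grad_eq (f : Pl → ℝ) (x : Pl) : ‖gradient f x‖ = ‖fderiv ℝ f x‖ := by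
  simp [gradient]

lemma fderiv_zero_of_zero {f : Pl → ℝ} (h0 : ∀ x, 0 ≤ f x) {x : Pl} (hx : f x = 0) :
    fderiv ℝ f x = 0 :=
  IsLocalMin.fderiv_eq_zero (Eventually.of_forall fun y => by rw [hx]; exact h0 y)

/-- the square root of the Fisher density -/
lemma fisher_split {f : Pl → ℝ} (h0 : ∀ x, 0 ≤ f x) (x : Pl) :
    ‖fderiv ℝ f x‖ = √(f x) * √(‖gradient f x‖ ^ 2 / f x) := by
  rw [grad_eq, ← Real.sqrt_mul (h0 x)]
  rcases (h0 x).eq_or_lt with h | h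
  · simp [fderiv_zero_of_zero h0 h.symm]
  · rw [mul_div_cancel₀ _ h.ne', Real.sqrt_sq (norm_nonneg _)]

lemma ofReal_sqrt_sq {a : ℝ} (ha : 0 ≤ a) : ENNReal.ofReal (√a) ^ 2 = ENNReal.ofReal a := by
  rw [← ENNReal.ofReal_pow (Real.sqrt_nonneg _), Real.sq_sqrt ha]

lemma cube_bound : ∃ K : ℝ≥0, ∀ f : Pl → ℝ,
        (∀ x, 0 ≤ f x) → ContDiff ℝ 1 f → Integrable f →
        Integrable (fun x => ‖gradient f x‖ ^ 2 / f x) →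
        Integrable (fun x => f x ^ 3) →
        ∫⁻ x, ENNReal.ofReal (f x ^ 3) ≤ K * (∫⁻ x, ENNReal.ofReal (f x)) *
          (∫⁻ x, ENNReal.ofReal (‖gradient f x‖ ^ 2 / f x)) ^ 2 := by
  obtain ⟨K, hK⟩ := sob_int
  refine ⟨K * (3/2) ^ 2 * K, fun f h0 hf hi hI h3 => ?_⟩
  set G : Pl → ℝ := fun x => ‖gradient f x‖ ^ 2 / f x with hG
  have hG0 : ∀ x, 0 ≤ G x := fun x => div_nonneg (sq_nonneg _) (h0 x)
  have hfm : Measurable f := hf.continuous.measurable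
  have hgm : AEMeasurable (fun x => ENNReal.ofReal (√(G x))) :=
    (hI.aemeasurable.sqrt).ennreal_ofReal
  have e2 : ∫⁻ x, ENNReal.ofReal (f x) ^ 2 ≤
      K * ((∫⁻ x, ENNReal.ofReal (f x)) * ∫⁻ x, ENNReal.ofReal (G x)) := by
    have a := hK f hf hi
    have b : ∀ x, ‖fderiv ℝ f x‖ₑ = ENNReal.ofReal (√(f x)) * ENNReal.ofReal (√(G x)) := by
      intro x
      rw [← ofReal_norm, fisher_split h0 x, ENNReal.ofReal_mul (Real.sqrt_nonneg _)]
    simp only [b, Real.enorm_eq_ofReal (h0 _)] at a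
    refine a.trans ?_
    gcongr
    refine (cs_sq hfm.sqrt.ennreal_ofReal.aemeasurable hgm).trans ?_
    simp only [ofReal_sqrt_sq (h0 _), ofReal_sqrt_sq (hG0 _)]
    rfl
  let u : Pl → ℝ := fun x => f x ^ ((3:ℝ)/2)
  have hu : ContDiff ℝ 1 u := by
    have : ContDiff ℝ (1:ℕ) fun x : ℝ => x ^ ((3:ℝ)/2) :=
      contDiff_rpow_const_of_le (by norm_num)
    exact this.comp hf
  have husq : ∀ x, u x ^ 2 = f x ^ 3 := fun x => by
    simp only [u]
    rw [← Real.rpow_natCast, ← Real.rpow_mul (h0 x), ← Real.rpow_natCast]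
    norm_num
  have hu0 : ∀ x, 0 ≤ u x := fun x => Real.rpow_nonneg (h0 x) _
  have hui : Integrable u := by
    refine (hi.add h3).mono' hu.continuous.aestronglyMeasurable (Eventually.of_forall fun x => ?_)
    rw [Real.norm_eq_abs, abs_of_nonneg (hu0 x)]
    show u x ≤ f x + f x ^ 3
    refine abs_le_of_sq_le_sq' ?_ (add_nonneg (h0 x) (pow_nonneg (h0 x) 3)) |>.2
    rw [husq]
    have := h0 x
    nlinarith [mul_nonneg (mul_nonneg this this) (sq_nonneg (f x ^ 2)),
      sq_nonneg (f x * (f x - 1)), mul_nonneg this (mul_nonneg this (sq_nonneg (f x - 1))),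
      mul_nonneg this (mul_nonneg this (sq_nonneg (f x ^ 2 - 1))), pow_nonneg this 3,
      pow_nonneg this 4]
  have b3 : ∀ x, ‖fderiv ℝ u x‖ₑ =
      (3/2 : ℝ≥0) * (ENNReal.ofReal (f x) * ENNReal.ofReal (√(G x))) := by
    intro x
    have d := (Real.hasDerivAt_rpow_const (x := f x) (p := (3:ℝ)/2) (Or.inr (by norm_num))
      ).comp_hasFDerivAt x ((hf.differentiable (by norm_num)) x).hasFDerivAt
    have d' : fderiv ℝ u x = _ := d.fderiv
    rw [d', ← ofReal_norm, norm_smul, fisher_split h0 x, Real.norm_eq_abs, abs_of_nonneg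
      (mul_nonneg (by norm_num) (Real.rpow_nonneg (h0 x) _)), ← ENNReal.ofReal_mul (h0 x),
      ENNReal.coe_nnreal_eq, ← ENNReal.ofReal_mul (by positivity)]
    congr 1
    have : (3:ℝ)/2 - 1 = 1/2 := by norm_num
    rw [this, ← Real.sqrt_eq_rpow]
    have := Real.mul_self_sqrt (h0 x)
    push_cast
    linear_combination (3/2 * √(G x)) * this
  have e3 : ∫⁻ x, ENNReal.ofReal (f x ^ 3) ≤
      K * ((3/2 : ℝ≥0) ^ 2 * ((∫⁻ x, ENNReal.ofReal (f x) ^ 2) * ∫⁻ x, ENNReal.ofReal (G x))) := by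
    have a := hK u hu hui
    simp only [b3, Real.enorm_eq_ofReal (hu0 _), ← ENNReal.ofReal_pow (hu0 _), husq] at a
    rw [lintegral_const_mul' _ _ ENNReal.coe_ne_top, mul_pow] at a
    refine a.trans ?_
    gcongr
    refine (cs_sq hfm.ennreal_ofReal.aemeasurable hgm).trans ?_
    simp only [ofReal_sqrt_sq (hG0 _)]
    rfl
  calc _ ≤ _ := e3
    _ ≤ (K:ℝ≥0∞) * ((3/2 : ℝ≥0) ^ 2 * ((K * ((∫⁻ x, ENNReal.ofReal (f x)) *
        ∫⁻ x, ENNReal.ofReal (G x))) * ∫⁻ x, ENNReal.ofReal (G x))) := by gcongr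
    _ = _ := by push_cast; ring

/-- There is a universal constant `C > 0` such that every nonnegative `C¹` function
`f` on `ℝ²` with finite mass, finite Fisher information `I(f) = ∫ ‖∇f‖²/f` and finite
`∫ f³` satisfies, for every `A > 1`,
`∫_{f ≥ A} f² ≤ C M^{1/2} (H⁺(f)/log A)^{1/2} I(f)`, where `H⁺(f) = ∫ f (log f)₊`. -/
theorem square_tail_bound_by_fisher :
    ∃ C : ℝ, 0 < C ∧
      ∀ f : EuclideanSpace ℝ (Fin 2) → ℝ,
        (∀ x, 0 ≤ f x) → ContDiff ℝ 1 f → Integrable f →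
        Integrable (fun x => ‖gradient f x‖ ^ 2 / f x) →
        Integrable (fun x => f x ^ 3) →
        ∀ A : ℝ, 1 < A →
        ∫ x in {x | A ≤ f x}, f x ^ 2 ≤
          C * (∫ x, f x) ^ ((1 : ℝ) / 2) *
            ((∫ x, f x * max (Real.log (f x)) 0) / Real.log A) ^ ((1 : ℝ) / 2) *
            ∫ x, ‖gradient f x‖ ^ 2 / f x := by
  obtain ⟨K, hK⟩ := cube_bound
  refine ⟨√(K + 1), by positivity, fun f h0 hf hi hI h3 A hA => ?_⟩
  have hK := hK f h0 hf hi hI h3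
  have hfm : Measurable f := hf.continuous.measurable
  have hI0 : ∀ x, 0 ≤ ‖gradient f x‖ ^ 2 / f x := fun x => div_nonneg (sq_nonneg _) (h0 x)
  have hL : 0 < Real.log A := Real.log_pos hA
  set S := {x | A ≤ f x} with hS
  have hSm : MeasurableSet S := measurableSet_le measurable_const hfm
  -- integrability
  have h2 : Integrable (fun x => f x ^ 2) := by
    refine (hi.add h3).mono' (by fun_prop) (Eventually.of_forall fun x => ?_)
    rw [Real.norm_eq_abs, abs_of_nonneg (sq_nonneg _)]
    show f x ^ 2 ≤ f x + f x ^ 3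
    have := h0 x
    nlinarith [mul_nonneg this (sq_nonneg (f x - 1))]
  have hH0 : ∀ x, 0 ≤ f x * max (Real.log (f x)) 0 := fun x =>
    mul_nonneg (h0 x) (le_max_right _ _)
  have hHi : Integrable (fun x => f x * max (Real.log (f x)) 0) := by
    refine h2.mono' (by fun_prop) (Eventually.of_forall fun x => ?_)
    rw [Real.norm_eq_abs, abs_of_nonneg (hH0 x), sq]
    exact mul_le_mul_of_nonneg_left (max_le (Real.log_le_self (h0 x)) (h0 x)) (h0 x)
  -- real version of cube bound
  rw [← ofReal_integral_eq_lintegral_ofReal h3 (Eventually.of_forall fun x => pow_nonneg (h0 x) 3),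
    ← ofReal_integral_eq_lintegral_ofReal hi (Eventually.of_forall h0),
    ← ofReal_integral_eq_lintegral_ofReal hI (Eventually.of_forall hI0)] at hK
  set M := ∫ x, f x with hM
  set I := ∫ x, ‖gradient f x‖ ^ 2 / f x with hIdef
  set H := ∫ x, f x * max (Real.log (f x)) 0 with hH
  have hM0 : 0 ≤ M := integral_nonneg h0
  have hII : 0 ≤ I := integral_nonneg hI0
  have hHH : 0 ≤ H := integral_nonneg hH0
  rw [ENNReal.coe_nnreal_eq, ← ENNReal.ofReal_pow hII, ← ENNReal.ofReal_mul (NNReal.coe_nonneg K),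
    ← ENNReal.ofReal_mul (by positivity), ENNReal.ofReal_le_ofReal_iff (by positivity)] at hK
  -- tail mass
  have htail : ∫ x in S, f x ≤ H / Real.log A := by
    rw [le_div_iff₀ hL, ← integral_mul_const]
    refine le_trans ?_ (setIntegral_le_integral hHi (s := S) (Eventually.of_forall hH0))
    refine setIntegral_mono_on (hi.integrableOn.mul_const _) hHi.integrableOn hSm fun x hx => ?_
    refine mul_le_mul_of_nonneg_left (le_max_of_le_left ?_) (h0 x)
    exact Real.log_le_log (by linarith) hx
  -- Cauchy-Schwarz
  have hcs : (∫ x in S, f x ^ 2) ^ 2 ≤ (∫ x in S, f x) * ∫ x in S, f x ^ 3 := by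
    have := cs_sq (μ := volume.restrict S) (g := fun x => ENNReal.ofReal (√(f x)))
      (h := fun x => ENNReal.ofReal (√(f x ^ 3))) (hfm.sqrt.ennreal_ofReal.aemeasurable)
      ((hfm.pow_const 3).sqrt.ennreal_ofReal.aemeasurable)
    simp only [ofReal_sqrt_sq (h0 _), ofReal_sqrt_sq (pow_nonneg (h0 _) 3),
      ← ENNReal.ofReal_mul (Real.sqrt_nonneg _), ← Real.sqrt_mul (h0 _)] at this
    have e : ∀ x, √(f x * f x ^ 3) = f x ^ 2 := fun x => by
      rw [show f x * f x ^ 3 = (f x ^ 2) ^ 2 by ring, Real.sqrt_sq (sq_nonneg _)]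
    simp only [e] at this
    rw [← ofReal_integral_eq_lintegral_ofReal h3.integrableOn
        (Eventually.of_forall fun x => pow_nonneg (h0 x) 3),
      ← ofReal_integral_eq_lintegral_ofReal hi.integrableOn (Eventually.of_forall h0),
      ← ofReal_integral_eq_lintegral_ofReal h2.integrableOn
        (Eventually.of_forall fun x => sq_nonneg (f x)),
      ← ENNReal.ofReal_pow (integral_nonneg fun x => sq_nonneg (f x)),
      ← ENNReal.ofReal_mul (integral_nonneg h0), ENNReal.ofReal_le_ofReal_iff
        (mul_nonneg (integral_nonneg h0) (integral_nonneg fun x => pow_nonneg (h0 x) 3))] at this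
    exact this
  have h3S : ∫ x in S, f x ^ 3 ≤ ∫ x, f x ^ 3 :=
    setIntegral_le_integral h3 (Eventually.of_forall fun x => pow_nonneg (h0 x) 3)
  have hHL : 0 ≤ H / Real.log A := div_nonneg hHH hL.le
  rw [← Real.sqrt_eq_rpow, ← Real.sqrt_eq_rpow]
  refine abs_le_of_sq_le_sq' ?_ (by positivity) |>.2
  rw [mul_pow, mul_pow, mul_pow, Real.sq_sqrt (by positivity), Real.sq_sqrt hM0, Real.sq_sqrt hHL]
  calc _ ≤ _ := hcs
    _ ≤ (H / Real.log A) * ∫ x in S, f x ^ 3 :=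
      mul_le_mul_of_nonneg_right htail (integral_nonneg fun x => pow_nonneg (h0 x) 3)
    _ ≤ (H / Real.log A) * (K * M * I ^ 2) := mul_le_mul_of_nonneg_left (h3S.trans hK) hHL
    _ ≤ (H / Real.log A) * ((K + 1) * M * I ^ 2) := by gcongr; linarith
    _ = _ := by ring
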